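/- (Koebe one-quarter theorem) If f : 𝔻 → ℂ is holomorphic and injective with f(0) = 0 and f′(0) = 1, then the image f(𝔻) contains the open disc of radius 1/4 centred at 0. -/

import Mathlib

open Complex Metric Set

lemma exists_sqrt_aux (φ : ℂ → ℂ) (hφ : DifferentiableOn ℂ φ (ball 0 1))
    (hne : ∀ z ∈ ball (0:ℂ) 1, φ z ≠ 0) (h0 : φ 0 = 1) :
    ∃ χ : ℂ → ℂ, DifferentiableOn ℂ χ (ball 0 1) ∧ χ 0 = 1 ∧
      ∀ z ∈ ball (0:ℂ) 1, χ z ^ 2 * φ z = 1 := by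
  have hd : DifferentiableOn ℂ (fun z => deriv φ z / φ z) (ball 0 1) :=
    (hφ.deriv isOpen_ball).div hφ hne
  obtain ⟨L, hL⟩ := hd.isExactOn_ball
  have h0m : (0:ℂ) ∈ ball (0:ℂ) 1 := by simp
  have hLd : DifferentiableOn ℂ L (ball 0 1) := fun z hz =>
    (hL z hz).differentiableAt.differentiableWithinAt
  refine ⟨fun z => exp (-(L z - L 0) / 2), by fun_prop, by simp, ?_⟩
  have key : ∀ z ∈ ball (0:ℂ) 1, exp (-(L z - L 0)) * φ z = exp (-(L 0 - L 0)) * φ 0 := by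
    intro z hz
    refine (convex_ball (0:ℂ) 1).is_const_of_fderivWithin_eq_zero (𝕜 := ℂ)
      (f := fun z => exp (-(L z - L 0)) * φ z) (by fun_prop) ?_ hz h0m
    intro w hw
    have h1 := (hL w hw)
    have h2 := (hφ.differentiableAt (isOpen_ball.mem_nhds hw)).hasDerivAt
    have h3 : HasDerivAt (fun z => exp (-(L z - L 0)) * φ z) 0 w := by
      refine HasDerivAt.congr_deriv ((h1.sub_const (L 0)).neg.cexp.mul h2) ?_
      have := hne w hw
      simp only [Pi.neg_apply]
      field_simp
      ring
    rw [fderivWithin_of_isOpen isOpen_ball hw, h3.hasFDerivAt.fderiv]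
    simp
  intro z hz
  have := key z hz
  simp only [sub_self, neg_zero, exp_zero, h0, mul_one] at this
  rw [← this, ← Complex.exp_nat_mul]
  congr 2
  push_cast; ring

lemma det_mul_aux (a : ℂ) :
    (a • (1 : ℂ →L[ℝ] ℂ)).det = ‖a‖ ^ 2 := by
  rw [ContinuousLinearMap.det, ← LinearMap.det_toMatrix basisOneI, Matrix.det_fin_two,
    ← normSq_eq_norm_sq, normSq_apply]
  simp [LinearMap.toMatrix_apply]

noncomputable def TT (c : ℂ) : ℂ →L[ℝ] ℂ :=
  ContinuousLinearMap.id ℝ ℂ + c • (conjCLE : ℂ →L[ℝ] ℂ)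

lemma TT_apply (c u : ℂ) : TT c u = u + c * (starRingEnd ℂ) u := by simp [TT]

lemma TT_det (c : ℂ) : LinearMap.det (TT c : ℂ →ₗ[ℝ] ℂ) = 1 - ‖c‖^2 := by
  rw [← LinearMap.det_toMatrix basisOneI, Matrix.det_fin_two, ← normSq_eq_norm_sq, normSq_apply]
  simp [LinearMap.toMatrix_apply, TT_apply]
  ring

lemma TT_surj (c : ℂ) (hc : ‖c‖ < 1) (w : ℂ) : ∃ u, TT c u = w := by
  have h : (1 - (‖c‖:ℂ)^2) ≠ 0 := by
    norm_cast
    nlinarith [norm_nonneg c]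
  refine ⟨(w - c * (starRingEnd ℂ) w) / (1 - (‖c‖:ℂ)^2), ?_⟩
  rw [TT_apply]
  simp only [map_div₀, map_sub, map_mul, map_one, map_pow, conj_ofReal, conj_conj]
  field_simp
  rw [← mul_conj' c]
  ring

lemma TT_bound (c u : ℂ) : (1 - ‖c‖) * ‖u‖ ≤ ‖TT c u‖ := by
  rw [TT_apply]
  have := norm_sub_le (u + c * (starRingEnd ℂ) u) (c * (starRingEnd ℂ) u)
  simp at this
  linarith

lemma TT_bound' (c u : ℂ) : ‖TT c u‖ ≤ (1 + ‖c‖) * ‖u‖ := by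
  rw [TT_apply]
  have := norm_add_le u (c * (starRingEnd ℂ) u)
  simp at this
  linarith

lemma preconn_aux (R : ℝ) (hR : 0 < R) : IsPreconnected {u : ℂ | R < ‖u‖} := by
  have : {u : ℂ | R < ‖u‖} = exp '' {z : ℂ | Real.log R < z.re} := by
    ext u
    simp only [mem_ofPred_eq, mem_image]
    constructor
    · intro h
      have hu : u ≠ 0 := norm_pos_iff.mp (hR.trans h)
      exact ⟨log u, by rw [log_re]; exact Real.log_lt_log hR h, exp_log hu⟩
    · rintro ⟨z, hz, rfl⟩
      rw [norm_exp]
      exact (Real.log_lt_iff_lt_exp hR).mp hz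
  rw [this]
  exact ((convex_halfSpace_re_gt _).isPreconnected).image _ continuous_exp.continuousOn

lemma avg_aux (D : ℂ → ℂ) (hD : DifferentiableOn ℂ D (ball 0 1)) (ρ : ℝ) (h0 : 0 < ρ) (h1 : ρ < 1) :
    2 * Real.pi * (ρ⁻¹ ^ 4 + ‖D 0‖ ^ 2) ≤
      ∫ θ in (-Real.pi)..Real.pi, ‖D (circleMap 0 ρ θ) - ((circleMap 0 ρ θ)^2)⁻¹‖ ^ 2 := by
  set b := D 0
  set Q : ℂ → ℂ := fun z => 2 * (starRingEnd ℂ) b * D z - (‖b‖:ℂ)^2 + (ρ:ℂ)⁻¹^4 - 2 * D z * z^2 * (ρ:ℂ)⁻¹^4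
    with hQ
  have hsub : closedBall (0:ℂ) |ρ| ⊆ ball 0 1 := by
    rw [abs_of_pos h0]; exact closedBall_subset_ball h1
  have hcl : closure (ball (0:ℂ) |ρ|) ⊆ ball 0 1 := closure_ball_subset_closedBall.trans hsub
  have hQd : DifferentiableOn ℂ Q (ball 0 1) := by fun_prop
  have hmean := (hQd.mono hcl).diffContOnCl.circleAverage
  rw [Real.circleAverage_eq_integral_add (-Real.pi)] at hmean
  have hc : ∀ θ, circleMap 0 ρ θ ∈ ball (0:ℂ) 1 := fun θ => hsub (by
    rw [abs_of_pos h0]; exact circleMap_mem_closedBall 0 h0.le θ)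
  have hDc : Continuous fun θ => D (circleMap 0 ρ θ) :=
    hD.continuousOn.comp_continuous (continuous_circleMap 0 ρ) hc
  have hQc : Continuous fun θ => Q (circleMap 0 ρ θ) :=
    hQd.continuousOn.comp_continuous (continuous_circleMap 0 ρ) hc
  have e1 : ∫ θ in (0:ℝ)..2 * Real.pi, Q (circleMap 0 ρ (θ + -Real.pi)) =
      ∫ θ in (-Real.pi)..Real.pi, Q (circleMap 0 ρ θ) := by
    rw [intervalIntegral.integral_comp_add_right (fun θ => Q (circleMap 0 ρ θ))]
    congr 1 <;> ring
  rw [e1] at hmean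
  have hpi := Real.pi_pos
  have hQ0 : Q 0 = ((ρ⁻¹ ^ 4 + ‖b‖ ^ 2 : ℝ) : ℂ) := by
    simp only [hQ]
    push_cast
    rw [show D 0 = b from rfl, mul_assoc, conj_mul']
    ring
  have e2 : ∫ θ in (-Real.pi)..Real.pi, (Q (circleMap 0 ρ θ)).re = 2 * Real.pi * (ρ⁻¹ ^ 4 + ‖b‖ ^ 2) := by
    have h3 : ∫ θ in (-Real.pi)..Real.pi, Q (circleMap 0 ρ θ) = ((2 * Real.pi * (ρ⁻¹ ^ 4 + ‖b‖ ^ 2) : ℝ) : ℂ) := by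
      rw [hQ0] at hmean
      push_cast at hmean ⊢
      rw [← hmean]
      simp only [real_smul]
      push_cast
      have : (Real.pi : ℂ) ≠ 0 := by exact_mod_cast hpi.ne'
      field_simp
    have h4 := (reCLM).intervalIntegral_comp_comm (hQc.intervalIntegrable (μ := MeasureTheory.volume) (-Real.pi) Real.pi)
    simp only [reCLM_apply] at h4
    rw [h4, h3, ofReal_re]
  rw [← e2]
  have hz0 : ∀ θ, circleMap 0 ρ θ ≠ 0 := fun θ => circleMap_ne_center h0.ne'
  apply intervalIntegral.integral_mono_on (by linarith)
  · exact (continuous_re.comp hQc).intervalIntegrable _ _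
  · apply Continuous.intervalIntegrable
    have : Continuous fun θ => ((circleMap 0 ρ θ)^2)⁻¹ :=
      ((continuous_circleMap 0 ρ).pow 2).inv₀ (fun θ => pow_ne_zero 2 (hz0 θ))
    exact ((hDc.sub this).norm).pow 2
  · intro θ _
    have hn : ‖circleMap 0 ρ θ‖ = ρ := by simp [abs_of_pos h0]
    have hz := hz0 θ
    generalize circleMap 0 ρ θ = z at hn hz
    have hzi : (z^2)⁻¹ = (starRingEnd ℂ) (z^2) * (ρ:ℂ)⁻¹^4 := by
      have : z * (starRingEnd ℂ) z = (ρ:ℂ)^2 := by rw [mul_conj', hn]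
      have hr : (ρ:ℂ) ≠ 0 := by exact_mod_cast h0.ne'
      rw [inv_eq_iff_eq_inv]
      apply eq_inv_of_mul_eq_one_left
      rw [map_pow, ← mul_assoc, ← mul_pow, this]
      field_simp
    have hzn : ‖(z^2)⁻¹‖ ^ 2 = ρ⁻¹^4 := by
      rw [norm_inv, norm_pow, hn]; ring
    have e3 : ‖D z - (z^2)⁻¹‖^2 = ‖D z‖^2 + ‖(z^2)⁻¹‖^2 - 2 * (D z * (starRingEnd ℂ) ((z^2)⁻¹)).re := by
      simp only [← normSq_eq_norm_sq]
      exact normSq_sub _ _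
    have e4 : ‖D z - b‖^2 = ‖D z‖^2 + ‖b‖^2 - 2 * (D z * (starRingEnd ℂ) b).re := by
      simp only [← normSq_eq_norm_sq]
      exact normSq_sub _ _
    rw [e3, hzn, hzi]
    have e5 : Q z = 2 * (D z * (starRingEnd ℂ) b) - ((‖b‖^2 : ℝ):ℂ) + ((ρ⁻¹^4 : ℝ):ℂ) - 2 * (D z * (starRingEnd ℂ) ((starRingEnd ℂ) (z^2) * (ρ:ℂ)⁻¹^4)) := by
      simp only [hQ, map_mul, conj_conj, map_pow, map_inv₀, conj_ofReal]
      push_cast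
      ring
    have e6 : (Q z).re = 2 * (D z * (starRingEnd ℂ) b).re - ‖b‖^2 + ρ⁻¹^4 - 2 * (D z * (starRingEnd ℂ) ((starRingEnd ℂ) (z^2) * (ρ:ℂ)⁻¹^4)).re := by
      rw [e5, sub_re, add_re, sub_re, ofReal_re, ofReal_re]
      congr 1
      · simp
      · rw [show (2:ℂ) = ((2:ℝ):ℂ) by norm_num, re_ofReal_mul]
    rw [e6]
    have := sq_nonneg ‖D z - b‖
    linarith

open MeasureTheory ENNReal

lemma lower_aux (D H : ℂ → ℂ) (hD : DifferentiableOn ℂ D (ball 0 1)) (hH : Measurable H)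
    (hHD : ∀ z ∈ ball (0:ℂ) 1, z ≠ 0 → H z = D z - (z^2)⁻¹)
    (r s : ℝ) (hr : 0 < r) (hrs : r < s) (hs : s < 1) :
    ENNReal.ofReal (Real.pi * (r⁻¹^2 - s⁻¹^2) + Real.pi * ‖D 0‖^2 * (s^2 - r^2)) ≤
      ∫⁻ z in {z : ℂ | r < ‖z‖ ∧ ‖z‖ < s}, ENNReal.ofReal (‖H z‖^2) := by
  have hS : MeasurableSet {z : ℂ | r < ‖z‖ ∧ ‖z‖ < s} :=
    (measurableSet_lt measurable_const measurable_norm).inter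
      (measurableSet_lt measurable_norm measurable_const)
  have hpi := Real.pi_pos
  rw [← lintegral_indicator hS, ← Complex.lintegral_comp_polarCoord_symm, polarCoord_target,
    Measure.volume_eq_prod, ← Measure.prod_restrict]
  have hm : Measurable ({z : ℂ | r < ‖z‖ ∧ ‖z‖ < s}.indicator fun z => ENNReal.ofReal (‖H z‖^2)) :=
    (by fun_prop : Measurable fun z => ENNReal.ofReal (‖H z‖^2)).indicator hS
  have hpm : Measurable fun p : ℝ × ℝ => Complex.polarCoord.symm p := by
    simp only [Complex.polarCoord_symm_apply]; fun_prop
  rw [lintegral_prod _ (by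
    apply Measurable.aemeasurable
    simp only [smul_eq_mul]
    exact (by fun_prop : Measurable fun p : ℝ × ℝ => ENNReal.ofReal p.1).mul (hm.comp hpm))]
  have step : ∀ ρ ∈ Ioo r s, ENNReal.ofReal (2 * Real.pi * (ρ⁻¹^3 + ‖D 0‖^2 * ρ)) ≤
      ∫⁻ θ in Ioo (-Real.pi) Real.pi, ENNReal.ofReal ρ •
        ({z : ℂ | r < ‖z‖ ∧ ‖z‖ < s}.indicator (fun z => ENNReal.ofReal (‖H z‖^2))
          (Complex.polarCoord.symm (ρ, θ))) := by
    rintro ρ ⟨h1, h2⟩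
    have hρ : 0 < ρ := hr.trans h1
    have hρ1 : ρ < 1 := h2.trans hs
    have hcm : ∀ θ, Complex.polarCoord.symm (ρ, θ) = circleMap 0 ρ θ := by
      intro θ
      rw [Complex.polarCoord_symm_apply, circleMap, exp_mul_I]
      simp
    have hn : ∀ θ, ‖circleMap 0 ρ θ‖ = ρ := fun θ => by simp [abs_of_pos hρ]
    have hmem : ∀ θ, circleMap 0 ρ θ ∈ ball (0:ℂ) 1 := fun θ => by
      rw [mem_ball_zero_iff, hn]; exact hρ1
    have hz0 : ∀ θ, circleMap 0 ρ θ ≠ 0 := fun θ => circleMap_ne_center hρ.ne'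
    have e : ∀ θ, {z : ℂ | r < ‖z‖ ∧ ‖z‖ < s}.indicator (fun z => ENNReal.ofReal (‖H z‖^2))
          (Complex.polarCoord.symm (ρ, θ)) =
          ENNReal.ofReal (‖D (circleMap 0 ρ θ) - ((circleMap 0 ρ θ)^2)⁻¹‖ ^ 2) := by
      intro θ
      rw [hcm, indicator_of_mem (show circleMap 0 ρ θ ∈ {z : ℂ | r < ‖z‖ ∧ ‖z‖ < s} by
        refine ⟨?_, ?_⟩ <;> rw [hn] <;> assumption), hHD _ (hmem θ) (hz0 θ)]
    simp only [e, smul_eq_mul]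
    have hDc : Continuous fun θ => D (circleMap 0 ρ θ) :=
      hD.continuousOn.comp_continuous (continuous_circleMap 0 ρ) hmem
    have hic : Continuous fun θ => ((circleMap 0 ρ θ)^2)⁻¹ :=
      ((continuous_circleMap 0 ρ).pow 2).inv₀ (fun θ => pow_ne_zero 2 (hz0 θ))
    have hc : Continuous fun θ => ‖D (circleMap 0 ρ θ) - ((circleMap 0 ρ θ)^2)⁻¹‖ ^ 2 :=
      ((hDc.sub hic).norm).pow 2
    have hint : IntegrableOn (fun θ => ‖D (circleMap 0 ρ θ) - ((circleMap 0 ρ θ)^2)⁻¹‖ ^ 2)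
        (Ioo (-Real.pi) Real.pi) :=
      (hc.integrableOn_Icc).mono_set Ioo_subset_Icc_self
    rw [lintegral_const_mul _ (by exact hc.measurable.ennreal_ofReal),
      ← ofReal_integral_eq_lintegral_ofReal hint (by filter_upwards with θ; positivity),
      ← ENNReal.ofReal_mul hρ.le]
    apply ENNReal.ofReal_le_ofReal
    have := avg_aux D hD ρ hρ hρ1
    rw [intervalIntegral.integral_of_le (by linarith), integral_Ioc_eq_integral_Ioo] at this
    calc _ = ρ * (2 * Real.pi * (ρ⁻¹ ^ 4 + ‖D 0‖ ^ 2)) := by field_simp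
      _ ≤ _ := by gcongr
  calc _ = ∫⁻ ρ in Ioo r s, ENNReal.ofReal (2 * Real.pi * (ρ⁻¹^3 + ‖D 0‖^2 * ρ)) := by
        have hcont : ContinuousOn (fun ρ : ℝ => 2 * Real.pi * (ρ⁻¹^3 + ‖D 0‖^2 * ρ)) (Icc r s) := by
          have : ContinuousOn (fun ρ : ℝ => ρ⁻¹) (Icc r s) :=
            continuousOn_inv₀.mono fun x hx => (hr.trans_le hx.1).ne'
          fun_prop
        rw [← ofReal_integral_eq_lintegral_ofReal]
        · congr 1
          rw [← integral_Ioc_eq_integral_Ioo, ← intervalIntegral.integral_of_le hrs.le]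
          rw [intervalIntegral.integral_eq_sub_of_hasDerivAt
            (f := fun ρ => Real.pi * (-ρ⁻¹^2 + ‖D 0‖^2 * ρ^2))]
          · ring
          · intro x hx
            rw [uIcc_of_le hrs.le] at hx
            have hx0 : x ≠ 0 := (hr.trans_le hx.1).ne'
            have h1 := (((hasDerivAt_inv hx0).pow 2).neg.add
              (((hasDerivAt_id x).pow 2).const_mul (‖D 0‖^2))).const_mul Real.pi
            refine HasDerivAt.congr_deriv h1 ?_
            simp
            field_simp
          · rw [← uIcc_of_le hrs.le] at hcont
            exact hcont.intervalIntegrable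
        · exact (hcont.integrableOn_Icc).mono_set Ioo_subset_Icc_self
        · filter_upwards [self_mem_ae_restrict measurableSet_Ioo] with x hx
          have : 0 < x := hr.trans hx.1
          simp only [Pi.zero_apply]
          positivity
    _ ≤ _ := setLIntegral_mono' measurableSet_Ioo step
    _ ≤ _ := lintegral_mono_set fun x hx => hr.trans hx.1

lemma cover_aux (g : ℂ → ℂ) (hg : DifferentiableOn ℂ g (ball 0 1))
    (hinj : InjOn (fun z => z⁻¹ + z * g z) (ball 0 1 \ {0})) (C r : ℝ) (hC : 0 ≤ C)
    (hgC : ∀ z ∈ closedBall (0:ℂ) (1/2), ‖g z - g 0‖ ≤ C * ‖z‖)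
    (hr : 0 < r) (hr2 : r ≤ 1/2) (hc : ‖g 0 * r^2‖ ≤ 1/2) (u : ℂ) (hu : r⁻¹ + 2 * C * r^2 < ‖u‖) :
    TT (g 0 * r^2) u ∈ (fun z => z⁻¹ + z * g z) '' (ball 0 r \ {0}) := by
  set G : ℂ → ℂ := fun z => z⁻¹ + z * g z with hG
  set c := g 0 * (r:ℂ)^2 with hcdef
  set R := r⁻¹ + 2 * C * r^2 with hR
  have hRpos : 0 < R := by positivity
  have hsub : ball (0:ℂ) r ⊆ ball 0 1 := ball_subset_ball (by linarith)
  have hsub' : closedBall (0:ℂ) r ⊆ ball 0 1 := closedBall_subset_ball (by linarith)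
  have hGd : DifferentiableOn ℂ G (ball 0 1 \ {0}) := by
    apply DifferentiableOn.add
    · exact differentiableOn_inv.mono fun z hz => hz.2
    · exact differentiableOn_id.mul (hg.mono sdiff_subset)
  have hopen1 : IsOpen (ball (0:ℂ) 1 \ {0}) := isOpen_ball.sdiff isClosed_singleton
  have hopenr : IsOpen (ball (0:ℂ) r \ {0}) := isOpen_ball.sdiff isClosed_singleton
  have hA : IsOpen (G '' (ball 0 r \ {0})) := by
    rw [isOpen_iff_mem_nhds]
    rintro _ ⟨z, hz, rfl⟩
    have hz1 : z ∈ ball (0:ℂ) 1 \ {0} := ⟨hsub hz.1, hz.2⟩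
    have han : AnalyticAt ℂ G z := hGd.analyticAt (hopen1.mem_nhds hz1)
    rcases han.eventually_constant_or_nhds_le_map_nhds with h | h
    · exfalso
      have h2 : ∀ᶠ y in nhds z, y = z := by
        filter_upwards [h, hopen1.mem_nhds hz1] with y hy hy1
        exact hinj hy1 hz1 hy
      have h3 : ∀ᶠ y in nhdsWithin z {z}ᶜ, False := by
        filter_upwards [h2.filter_mono nhdsWithin_le_nhds, self_mem_nhdsWithin] with y hy hy1
        exact hy1 hy
      rw [Filter.eventually_false_iff_eq_bot] at h3
      exact (NormedField.nhdsNE_neBot z).ne h3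
    · exact h (Filter.image_mem_map (hopenr.mem_nhds hz))
  have hK : IsClosed (G '' (closedBall 0 r \ {0})) := by
    apply IsSeqClosed.isClosed
    intro x p hx hxp
    choose z hz hzx using hx
    obtain ⟨a, ha, φ, hφ, hlim⟩ := (isCompact_closedBall (0:ℂ) r).tendsto_subseq (fun n => (hz n).1)
    have hx' := hxp.comp hφ.tendsto_atTop
    have hgc : Filter.Tendsto (fun n => g (z (φ n))) Filter.atTop (nhds (g a)) :=
      ((hg.continuousOn.continuousAt (isOpen_ball.mem_nhds (hsub' ha))).tendsto).comp hlim
    have e1 : ∀ n, z (φ n) * x (φ n) = 1 + z (φ n)^2 * g (z (φ n)) := by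
      intro n
      have : z (φ n) ≠ 0 := (hz (φ n)).2
      rw [← hzx, hG]
      field_simp
    have l1 := hlim.mul hx'
    have l2 := ((hlim.pow 2).mul hgc).const_add 1
    have e2 : a * p = 1 + a^2 * g a := tendsto_nhds_unique l1 (l2.congr fun n => (e1 n).symm)
    have ha0 : a ≠ 0 := by
      rintro rfl
      simp at e2
    refine ⟨a, ⟨ha, ha0⟩, ?_⟩
    rw [hG]
    field_simp
    linear_combination -e2
  have hW : IsPreconnected (TT c '' {u : ℂ | R < ‖u‖}) :=
    (preconn_aux R hRpos).image _ (TT c).continuous.continuousOn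
  refine hW.subset_left_of_subset_union hA hK.isOpen_compl ?_ ?_ ?_ ⟨u, hu, rfl⟩
  · rw [disjoint_compl_right_iff_subset]
    exact image_mono (sdiff_subset_sdiff_left ball_subset_closedBall)
  · rintro _ ⟨v, hv, rfl⟩
    by_cases hv2 : TT c v ∈ G '' (closedBall 0 r \ {0})
    · left
      obtain ⟨z, hz, hzv⟩ := hv2
      have hz0 : z ≠ 0 := hz.2
      refine ⟨z, ⟨?_, hz.2⟩, hzv⟩
      by_contra hzn
      have hzr : ‖z‖ = r := by
        have h1 := hz.1
        rw [mem_closedBall_zero_iff] at h1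
        rw [mem_ball_zero_iff] at hzn
        linarith
      have hT : TT c (z⁻¹) = z⁻¹ + z * g 0 := by
        rw [TT_apply, hcdef, map_inv₀, ← hzr, ← mul_conj']
        have : (starRingEnd ℂ) z ≠ 0 := by simpa using hz0
        field_simp
      have hT2 : TT c (v - z⁻¹) = z * (g z - g 0) := by
        rw [map_sub, hT, ← hzv, hG]; ring
      have h1 := TT_bound c (v - z⁻¹)
      have h2 := hgC z (by rw [mem_closedBall_zero_iff]; linarith)
      rw [hT2, norm_mul z, hzr] at h1
      rw [hzr] at h2
      have h3 : r * ‖g z - g 0‖ ≤ r * (C * r) := by gcongr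
      have h4 : 1/2 * ‖v - z⁻¹‖ ≤ (1 - ‖c‖) * ‖v - z⁻¹‖ := by gcongr; linarith
      have h5 := norm_le_norm_add_norm_sub' v (z⁻¹)
      rw [norm_inv, hzr] at h5
      have hv' : R < ‖v‖ := hv
      rw [hR] at hv'
      nlinarith
    · exact Or.inr hv2
  · -- nonempty
    have hM : ∀ᶠ t : ℝ in nhdsWithin 0 (Ioi 0), t < r ∧ t^2 * (‖g 0‖ + C) < 1/2 ∧ 4 * R * t < 1 := by
      apply Filter.Eventually.filter_mono nhdsWithin_le_nhds
      refine (eventually_lt_nhds hr).and (Filter.Eventually.and ?_ ?_)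
      · have : Filter.Tendsto (fun t : ℝ => t^2 * (‖g 0‖ + C)) (nhds 0) (nhds (0^2 * (‖g 0‖ + C))) :=
          (by fun_prop : Continuous fun t : ℝ => t^2 * (‖g 0‖ + C)).tendsto 0
        exact this.eventually_lt_const (by norm_num)
      · have : Filter.Tendsto (fun t : ℝ => 4 * R * t) (nhds 0) (nhds (4 * R * 0)) :=
          (by fun_prop : Continuous fun t : ℝ => 4 * R * t).tendsto 0
        exact this.eventually_lt_const (by norm_num)
    obtain ⟨t, ⟨ht1, ht2, ht3⟩, ht0⟩ := (hM.and self_mem_nhdsWithin).exists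
    have ht0 : 0 < t := ht0
    have htn : ‖(t:ℂ)‖ = t := by simp [abs_of_pos ht0]
    have htc : (t:ℂ) ≠ 0 := by exact_mod_cast ht0.ne'
    obtain ⟨v, hv⟩ := TT_surj c (by linarith) (G t)
    refine ⟨G t, ⟨v, ?_, hv⟩, ⟨t, ⟨?_, htc⟩, rfl⟩⟩
    · have h1 := TT_bound' c v
      rw [hv] at h1
      have h2 := hgC t (by rw [mem_closedBall_zero_iff, htn]; linarith)
      rw [htn] at h2
      have h3 : ‖g t‖ ≤ ‖g 0‖ + C := by
        have := norm_le_norm_add_norm_sub' (g t) (g 0)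
        nlinarith
      have h4 : t⁻¹ ≤ ‖G t‖ + t * ‖g t‖ := by
        have := norm_sub_le (G t) (t * g t)
        rw [norm_mul, htn] at this
        rw [show G t - t * g t = (t:ℂ)⁻¹ by rw [hG]; ring, norm_inv, htn] at this
        exact this
      have h5 : 1 ≤ t * ‖G t‖ + t^2 * ‖g t‖ := by
        have := mul_le_mul_of_nonneg_left h4 ht0.le
        rw [mul_inv_cancel₀ ht0.ne'] at this
        linarith
      have h6 : t^2 * ‖g t‖ ≤ t^2 * (‖g 0‖ + C) := by gcongr
      have h7 : ‖G t‖ ≤ 2 * ‖v‖ := h1.trans (by gcongr; linarith)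
      show R < ‖v‖
      by_contra hcon
      have h8 : t * ‖G t‖ ≤ t * (2 * R) := by gcongr; linarith
      linarith
    · rw [mem_ball_zero_iff, htn]; exact ht1

lemma area_aux (g : ℂ → ℂ) (hg : DifferentiableOn ℂ g (ball 0 1))
    (hinj : InjOn (fun z => z⁻¹ + z * g z) (ball 0 1 \ {0})) : ‖g 0‖ ≤ 1 := by
  set G : ℂ → ℂ := fun z => z⁻¹ + z * g z with hG
  have hopen1 : IsOpen (ball (0:ℂ) 1 \ {0}) := isOpen_ball.sdiff isClosed_singleton
  have hpi := Real.pi_pos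
  obtain ⟨C, hC, hgC⟩ : ∃ C : ℝ, 0 ≤ C ∧ ∀ z ∈ closedBall (0:ℂ) (1/2), ‖g z - g 0‖ ≤ C * ‖z‖ := by
    have hd : DifferentiableOn ℂ (dslope g 0) (ball 0 1) :=
      (differentiableOn_dslope (isOpen_ball.mem_nhds (by simp))).mpr hg
    obtain ⟨C, hC⟩ := (isCompact_closedBall (0:ℂ) (1/2)).exists_bound_of_continuousOn
      (hd.continuousOn.mono (closedBall_subset_ball (by norm_num)))
    refine ⟨C, (norm_nonneg _).trans (hC 0 (by simp)), fun z hz => ?_⟩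
    have := sub_smul_dslope g 0 z
    rw [← this, norm_smul, sub_zero, mul_comm]
    gcongr
    exact hC z hz
  have hDd : DifferentiableOn ℂ (fun z => g z + z * deriv g z) (ball 0 1) :=
    hg.add (differentiableOn_id.mul (hg.deriv isOpen_ball))
  have hGder : ∀ z ∈ ball (0:ℂ) 1, z ≠ 0 → HasDerivAt G (g z + z * deriv g z - (z^2)⁻¹) z := by
    intro z hz hz0
    have h2 := (hg.differentiableAt (isOpen_ball.mem_nhds hz)).hasDerivAt
    refine HasDerivAt.congr_deriv ((hasDerivAt_inv hz0).add ((hasDerivAt_id z).mul h2)) ?_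
    simp
    ring
  have main : ∀ s : ℝ, 0 < s → s < 1 → ∀ᶠ r : ℝ in nhdsWithin 0 (Ioi 0),
      ‖g 0‖^2 * (s^2 - r^2) ≤ s⁻¹^2 + 4 * C * r + 4 * C^2 * r^4 := by
    intro s hs0 hs1
    have hev : ∀ᶠ r : ℝ in nhdsWithin 0 (Ioi 0), r < s ∧ r < 1/2 ∧ ‖g 0‖ * r^2 < 1/2 := by
      apply Filter.Eventually.filter_mono nhdsWithin_le_nhds
      refine (eventually_lt_nhds hs0).and ((eventually_lt_nhds (by norm_num)).and ?_)
      have : Filter.Tendsto (fun t : ℝ => ‖g 0‖ * t^2) (nhds 0) (nhds (‖g 0‖ * 0^2)) :=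
        (by fun_prop : Continuous fun t : ℝ => ‖g 0‖ * t^2).tendsto 0
      exact this.eventually_lt_const (by norm_num)
    filter_upwards [hev, self_mem_nhdsWithin] with r ⟨hrs, hr2, hrg⟩ hr
    have hr : 0 < r := hr
    set c := g 0 * (r:ℂ)^2 with hcdef
    have hc : ‖c‖ ≤ 1/2 := by
      rw [hcdef, norm_mul, norm_pow]
      simp only [norm_real, Real.norm_eq_abs, abs_of_pos hr]
      exact hrg.le
    set R := r⁻¹ + 2 * C * r^2 with hR
    have hRpos : 0 < R := by positivity
    set S := {z : ℂ | r < ‖z‖ ∧ ‖z‖ < s} with hSdef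
    have hS : MeasurableSet S :=
      (measurableSet_lt measurable_const measurable_norm).inter
        (measurableSet_lt measurable_norm measurable_const)
    have hS1 : S ⊆ ball 0 1 \ {0} := by
      rintro z ⟨h1, h2⟩
      refine ⟨by rw [mem_ball_zero_iff]; linarith, ?_⟩
      rintro rfl
      simp at h1
      linarith
    have hsubset : G '' S ⊆ TT c '' closedBall 0 R := by
      rintro _ ⟨z, hz, rfl⟩
      obtain ⟨u, hu⟩ := TT_surj c (by linarith) (G z)
      refine ⟨u, ?_, hu⟩
      by_contra hcon
      rw [mem_closedBall_zero_iff, not_le] at hcon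
      obtain ⟨y, hy, hyu⟩ := cover_aux g hg hinj C r hC hgC hr hr2.le hc u hcon
      have hyz : y = z := hinj ⟨ball_subset_ball (by linarith) hy.1, hy.2⟩ (hS1 hz) (hyu.trans hu)
      have h1 := hy.1
      rw [hyz, mem_ball_zero_iff] at h1
      exact absurd hz.1 (not_lt.mpr h1.le)
    have hvol : volume (G '' S) = ∫⁻ z in S, ENNReal.ofReal (‖deriv G z‖^2) := by
      have h1 := lintegral_image_eq_lintegral_abs_det_fderiv_mul volume hS
        (f := G) (f' := fun z => deriv G z • (1 : ℂ →L[ℝ] ℂ))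
        (fun z hz => by
          have h2 := hGder z (hS1 hz).1 (hS1 hz).2
          rw [← h2.deriv] at h2
          exact h2.complexToReal_fderiv.hasFDerivWithinAt)
        (hinj.mono hS1) (fun _ => 1)
      simpa [det_mul_aux] using h1
    have hlow := lower_aux (fun z => g z + z * deriv g z) (deriv G) hDd (measurable_deriv G)
      (fun z hz hz0 => (hGder z hz hz0).deriv) r s hr hrs hs1
    rw [← hvol] at hlow
    have hup : volume (G '' S) ≤ ENNReal.ofReal (Real.pi * R^2) := by
      refine (measure_mono hsubset).trans ?_
      rw [Measure.addHaar_image_continuousLinearMap, TT_det, Complex.volume_closedBall]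
      have h1 : |1 - ‖c‖^2| ≤ 1 := by
        rw [abs_le]; constructor <;> nlinarith [norm_nonneg c]
      have h2 : (NNReal.pi : ENNReal) = ENNReal.ofReal Real.pi := by
        rw [← NNReal.coe_real_pi, ENNReal.ofReal_coe_nnreal]
      rw [h2, ← ENNReal.ofReal_pow hRpos.le, ← ENNReal.ofReal_mul (by positivity),
        ← ENNReal.ofReal_mul (by positivity)]
      apply ENNReal.ofReal_le_ofReal
      calc _ ≤ 1 * (R^2 * Real.pi) := by gcongr
        _ = _ := by ring
    have h3 := hlow.trans hup
    rw [ENNReal.ofReal_le_ofReal_iff (by positivity)] at h3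
    simp only [zero_mul, add_zero] at h3
    have h4 : Real.pi * (r⁻¹ ^ 2 - s⁻¹ ^ 2 + ‖g 0‖ ^ 2 * (s ^ 2 - r ^ 2)) ≤ Real.pi * R^2 := by
      linarith
    have h5 := le_of_mul_le_mul_left h4 hpi
    have h6 : R^2 = r⁻¹^2 + 4 * C * r + 4 * C^2 * r^4 := by
      rw [hR]; field_simp; ring
    linarith
  have main2 : ∀ s : ℝ, 0 < s → s < 1 → ‖g 0‖ * s^2 ≤ 1 := by
    intro s hs0 hs1
    have t1 : Filter.Tendsto (fun r : ℝ => ‖g 0‖^2 * (s^2 - r^2)) (nhdsWithin 0 (Ioi 0))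
        (nhds (‖g 0‖^2 * (s^2 - 0^2))) :=
      ((by fun_prop : Continuous fun r : ℝ => ‖g 0‖^2 * (s^2 - r^2)).tendsto 0).mono_left
        nhdsWithin_le_nhds
    have t2 : Filter.Tendsto (fun r : ℝ => s⁻¹^2 + 4 * C * r + 4 * C^2 * r^4) (nhdsWithin 0 (Ioi 0))
        (nhds (s⁻¹^2 + 4 * C * 0 + 4 * C^2 * 0^4)) :=
      ((by fun_prop : Continuous fun r : ℝ => s⁻¹^2 + 4 * C * r + 4 * C^2 * r^4).tendsto 0).mono_left
        nhdsWithin_le_nhds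
    have h1 := le_of_tendsto_of_tendsto t1 t2 (main s hs0 hs1)
    have h2 : ‖g 0‖^2 * s^2 ≤ s⁻¹^2 := by simpa using h1
    have h3 : (‖g 0‖ * s^2)^2 ≤ 1 := by
      calc (‖g 0‖ * s^2)^2 = ‖g 0‖^2 * s^2 * s^2 := by ring
        _ ≤ s⁻¹^2 * s^2 := by gcongr
        _ = 1 := by field_simp
    exact (sq_le_one_iff₀ (by positivity)).mp h3
  have t1 : Filter.Tendsto (fun s : ℝ => ‖g 0‖ * s^2) (nhdsWithin 1 (Iio 1)) (nhds (‖g 0‖ * 1^2)) :=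
    ((by fun_prop : Continuous fun s : ℝ => ‖g 0‖ * s^2).tendsto 1).mono_left nhdsWithin_le_nhds
  have h := le_of_tendsto t1 (b := 1) (by
    filter_upwards [self_mem_nhdsWithin,
      Filter.Eventually.filter_mono nhdsWithin_le_nhds (eventually_gt_nhds (zero_lt_one' ℝ))] with s h1 h2
    exact main2 s h2 h1)
  simpa using h

lemma bieberbach_aux (φ : ℂ → ℂ) (hφ : DifferentiableOn ℂ φ (ball 0 1)) (h0 : φ 0 = 1)
    (hinj : InjOn (fun z => z * φ z) (ball 0 1)) : ‖deriv φ 0‖ ≤ 2 := by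
  have h0m : (0:ℂ) ∈ ball (0:ℂ) 1 := by simp
  have hne : ∀ z ∈ ball (0:ℂ) 1, φ z ≠ 0 := by
    intro z hz hz0
    have : z = 0 := hinj hz h0m (by simp [hz0])
    rw [this, h0] at hz0
    exact one_ne_zero hz0
  obtain ⟨χ, hχ, hχ0, hχφ⟩ := exists_sqrt_aux φ hφ hne h0
  have hd : DifferentiableOn ℂ (dslope χ 0) (ball 0 1) :=
    (differentiableOn_dslope (isOpen_ball.mem_nhds h0m)).mpr hχ
  have hsq : ∀ z ∈ ball (0:ℂ) 1, z^2 ∈ ball (0:ℂ) 1 := by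
    intro z hz
    rw [mem_ball_zero_iff] at hz ⊢
    rw [norm_pow]
    exact pow_lt_one₀ (norm_nonneg z) hz two_ne_zero
  have hG : ∀ z : ℂ, z ≠ 0 → z⁻¹ + z * dslope χ 0 (z^2) = χ (z^2) / z := by
    intro z hz
    have := sub_smul_dslope χ 0 (z^2)
    rw [hχ0, sub_zero, smul_eq_mul] at this
    field_simp
    linear_combination this
  have key := area_aux (fun z => dslope χ 0 (z^2))
    (hd.comp (by fun_prop : DifferentiableOn ℂ (fun z : ℂ => z^2) (ball 0 1)) hsq) (by
      rintro z ⟨hz, hz0⟩ y ⟨hy, hy0⟩ hzy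
      have hz0 : z ≠ 0 := hz0
      have hy0 : y ≠ 0 := hy0
      simp only [hG z hz0, hG y hy0] at hzy
      have e1 := hχφ _ (hsq z hz)
      have e2 := hχφ _ (hsq y hy)
      have n1 : χ (z^2) ≠ 0 := by
        intro h; simp [h] at e1
      have e3 : (χ (z^2) / z)^2 * (z^2 * φ (z^2)) = 1 := by
        rw [← e1]; field_simp
      have e4 : (χ (z^2) / z)^2 * (y^2 * φ (y^2)) = 1 := by
        rw [hzy, ← e2]; field_simp
      have e5 : z^2 * φ (z^2) = y^2 * φ (y^2) := by
        have : (χ (z^2) / z)^2 ≠ 0 := by positivity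
        exact mul_left_cancel₀ this (e3.trans e4.symm)
      have e6 : z^2 = y^2 := hinj (hsq z hz) (hsq y hy) e5
      rw [← e6] at hzy
      rw [div_eq_div_iff hz0 hy0] at hzy
      exact (mul_left_cancel₀ n1 hzy).symm)
  have e : dslope χ 0 ((0:ℂ)^2) = deriv χ 0 := by simp
  simp only [e] at key
  have d1 := (hχ.differentiableAt (isOpen_ball.mem_nhds h0m)).hasDerivAt
  have d2 := (hφ.differentiableAt (isOpen_ball.mem_nhds h0m)).hasDerivAt
  have d3 := (d1.pow 2).mul d2
  have d4 : HasDerivAt (χ ^ 2 * φ) 0 0 := by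
    apply (hasDerivAt_const (0:ℂ) (1:ℂ)).congr_of_eventuallyEq
    filter_upwards [isOpen_ball.mem_nhds h0m] with z hz
    exact hχφ z hz
  have d5 := d3.unique d4
  simp [hχ0, h0] at d5
  have d6 : deriv φ 0 = -(2 * deriv χ 0) := by linear_combination d5
  rw [d6, norm_neg, norm_mul]
  simp
  linarith

/-- Koebe one-quarter theorem: if `f` is an injective holomorphic
function on the unit disc with `f(0) = 0` and `f'(0) = 1`, then the image `f(𝔻)`
contains the open disc of radius `1/4` about `0`. -/
theorem koebe_one_quarter (f : ℂ → ℂ)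
    (hf : DifferentiableOn ℂ f (Metric.ball 0 1))
    (hinj : Set.InjOn f (Metric.ball 0 1))
    (h0 : f 0 = 0) (h1 : deriv f 0 = 1) :
    Metric.ball (0 : ℂ) (1 / 4) ⊆ f '' Metric.ball 0 1 := by
  intro w hw
  by_contra hwn
  have h0m : (0:ℂ) ∈ ball (0:ℂ) 1 := by simp
  have hw0 : w ≠ 0 := by
    rintro rfl
    exact hwn ⟨0, h0m, h0⟩
  have hwf : ∀ z ∈ ball (0:ℂ) 1, w - f z ≠ 0 := fun z hz h =>
    hwn ⟨z, hz, (sub_eq_zero.mp h).symm⟩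
  set φ := dslope f 0 with hφdef
  have hφ : DifferentiableOn ℂ φ (ball 0 1) :=
    (differentiableOn_dslope (isOpen_ball.mem_nhds h0m)).mpr hf
  have hφ0 : φ 0 = 1 := by rw [hφdef, dslope_same, h1]
  have hφf : ∀ z, z * φ z = f z := by
    intro z
    have := sub_smul_dslope f 0 z
    rwa [h0, sub_zero, sub_zero, smul_eq_mul] at this
  have b1 := bieberbach_aux φ hφ hφ0 (by simpa only [hφf] using hinj)
  have b2 := bieberbach_aux (fun z => φ z * (w / (w - f z)))
    (hφ.mul ((differentiableOn_const w).div ((differentiableOn_const w).sub hf) hwf))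
    (by simp [hφ0, h0, hw0]) (by
      intro z hz y hy hzy
      simp only [← mul_assoc, hφf] at hzy
      apply hinj hz hy
      have n1 := hwf z hz
      have n2 := hwf y hy
      field_simp at hzy
      have : w * (f z - f y) = 0 := by linear_combination hzy
      exact sub_eq_zero.mp ((mul_eq_zero.mp this).resolve_left hw0))
  have d1 := (hf.differentiableAt (isOpen_ball.mem_nhds h0m)).hasDerivAt
  have d2 := (hφ.differentiableAt (isOpen_ball.mem_nhds h0m)).hasDerivAt
  have d3 := d2.mul ((hasDerivAt_const (0:ℂ) w).div (d1.const_sub w) (hwf 0 h0m))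
  have d4 : deriv (fun z => φ z * (w / (w - f z))) 0 = deriv φ 0 + w⁻¹ := by
    refine d3.deriv.trans ?_
    simp [h0, h1, hφ0]
    field_simp
  rw [d4] at b2
  have n := norm_sub_le (deriv φ 0 + w⁻¹) (deriv φ 0)
  rw [add_sub_cancel_left, norm_inv] at n
  have hwp : 0 < ‖w‖ := norm_pos_iff.mpr hw0
  rw [mem_ball_zero_iff] at hw
  have : ‖w‖⁻¹ * ‖w‖ = 1 := inv_mul_cancel₀ hwp.ne'
  nlinarith
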